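/- Let m = n, let A, B ∈ ℝ^{n×n} with A − B nonsingular, and suppose Q = (Aᵀ+Bᵀ)(Aᵀ−Bᵀ)⁻¹ is a P-matrix (all principal minors of Q are positive). Then for every c ∈ ℝ^n, Fix(P_{C1} ∘ P_{C2}) = C1 ∩ C2. -/

import Mathlib

noncomputable section

/-- The (possibly multivalued) metric projection onto a set `S`. -/
def projSet {E : Type*} [NormedAddCommGroup E] (S : Set E) (z : E) : Set E :=
  {s ∈ S | ∀ t ∈ S, ‖s - z‖ ≤ ‖t - z‖}

/-- `C2 = {(u,v) ∈ ℝⁿ × ℝⁿ : u ≥ 0, v ≥ 0, ⟨u,v⟩ = 0}`. -/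
def C2set (n : ℕ) : Set (EuclideanSpace ℝ (Fin n ⊕ Fin n)) :=
  {w | (∀ i, 0 ≤ w (Sum.inl i)) ∧ (∀ i, 0 ≤ w (Sum.inr i)) ∧
       ∑ i, w (Sum.inl i) * w (Sum.inr i) = 0}

/-- `T(u,v) = (A+B)u + (−A+B)v`. -/
def Tmap {m n : ℕ} (A B : Matrix (Fin m) (Fin n) ℝ)
    (w : EuclideanSpace ℝ (Fin n ⊕ Fin n)) : Fin m → ℝ :=
  (A + B).mulVec (fun i => w (Sum.inl i)) + (-A + B).mulVec (fun i => w (Sum.inr i))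

/-- `C1 = {w : Tw = √2 c}`. -/
def C1set {m n : ℕ} (A B : Matrix (Fin m) (Fin n) ℝ) (c : Fin m → ℝ) :
    Set (EuclideanSpace ℝ (Fin n ⊕ Fin n)) :=
  {w | Tmap A B w = Real.sqrt 2 • c}

/-- The set of fixed points of `P_{C1} ∘ P_{C2}`. -/
def FixSet {m n : ℕ} (A B : Matrix (Fin m) (Fin n) ℝ) (c : Fin m → ℝ) :
    Set (EuclideanSpace ℝ (Fin n ⊕ Fin n)) :=
  {w | ∃ w' ∈ projSet (C2set n) w, w ∈ projSet (C1set A B c) w'}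

/-- `Ω = {(u,v) : for no i are both u_i < 0 and v_i < 0}`. -/
def OmegaSet (n : ℕ) : Set (EuclideanSpace ℝ (Fin n ⊕ Fin n)) :=
  {w | ∀ i, ¬(w (Sum.inl i) < 0 ∧ w (Sum.inr i) < 0)}

/-- A matrix is a P-matrix if all of its principal minors are positive. -/
def PMatrix {n : ℕ} (Q : Matrix (Fin n) (Fin n) ℝ) : Prop :=
  ∀ Λ : Finset (Fin n),
    (Q.submatrix (fun i : Λ => (i : Fin n)) (fun j : Λ => (j : Fin n))).det > 0

/-- Keeping the rows of `Q` indexed by `s` and replacing the others by rows of the identity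
gives a matrix whose determinant is the principal minor of `Q` indexed by `s`. -/
theorem det_piecewise_one {n : ℕ} (Q : Matrix (Fin n) (Fin n) ℝ) (s : Finset (Fin n)) :
    (Matrix.of (s.piecewise (fun i => Q i) fun i => (1 : Matrix (Fin n) (Fin n) ℝ) i)).det =
      (Q.submatrix (fun i : s => (i : Fin n)) (fun j : s => (j : Fin n))).det := by
  rw [Matrix.twoBlockTriangular_det _ (fun i => i ∈ s)]
  · have h1 : (Matrix.of (s.piecewise (fun i => Q i)
        fun i => (1 : Matrix (Fin n) (Fin n) ℝ) i)).toSquareBlockProp (fun i => i ∈ s) =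
        Q.submatrix (fun i : s => (i : Fin n)) (fun j : s => (j : Fin n)) := by
      ext i j
      simp [Matrix.toSquareBlockProp, Finset.piecewise, i.2]
    have h2 : (Matrix.of (s.piecewise (fun i => Q i)
        fun i => (1 : Matrix (Fin n) (Fin n) ℝ) i)).toSquareBlockProp (fun i => ¬ i ∈ s) = 1 := by
      ext i j
      simp [Matrix.toSquareBlockProp, Finset.piecewise, i.2, Matrix.one_apply, Subtype.ext_iff]
    rw [h1, h2, Matrix.det_one, mul_one]
    congr!
  · intro i hi j hj
    have hij : i ≠ j := fun h => hi (h ▸ hj)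
    simp [Finset.piecewise, hi, hij]

/-- If `Q` is a P-matrix then `diag a * Q + diag d` has positive determinant whenever `a` and `d`
are nonnegative and never vanish simultaneously. -/
theorem PMatrix.det_diagonal_mul_add_diagonal_pos {n : ℕ} {Q : Matrix (Fin n) (Fin n) ℝ}
    (hQ : PMatrix Q) {a d : Fin n → ℝ} (ha : ∀ i, 0 ≤ a i) (hd : ∀ i, 0 ≤ d i)
    (had : ∀ i, a i = 0 → 0 < d i) :
    0 < (Matrix.diagonal a * Q + Matrix.diagonal d).det := by
  have key : (Matrix.diagonal a * Q + Matrix.diagonal d).det =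
      ∑ s : Finset (Fin n), (∏ i, if i ∈ s then a i else d i) *
        (Q.submatrix (fun i : s => (i : Fin n)) (fun j : s => (j : Fin n))).det := by
    let f := (Matrix.detRowAlternating (n := Fin n) (R := ℝ)).toMultilinearMap
    have h1 : Matrix.diagonal a * Q + Matrix.diagonal d = Matrix.of
        ((fun i => a i • Q i) + fun i => d i • (1 : Matrix (Fin n) (Fin n) ℝ) i) := by
      ext i j
      simp [Matrix.diagonal_mul, Matrix.diagonal_apply, Matrix.one_apply]
    rw [h1]
    change f _ = _
    refine (f.map_add_univ _ _).trans (Finset.sum_congr rfl fun s _ => ?_)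
    have h2 : s.piecewise (fun i => a i • Q i) (fun i => d i • (1 : Matrix (Fin n) (Fin n) ℝ) i) =
        fun i => (if i ∈ s then a i else d i) •
          s.piecewise (fun i => Q i) (fun i => (1 : Matrix (Fin n) (Fin n) ℝ) i) i := by
      funext i
      by_cases hi : i ∈ s <;> simp [hi]
    rw [h2, ← det_piecewise_one]
    exact f.map_smul_univ _ _
  rw [key]
  refine Finset.sum_pos' (fun s _ => mul_nonneg (Finset.prod_nonneg fun i _ => ?_) (hQ s).le)
    ⟨Finset.univ.filter fun i => a i ≠ 0, Finset.mem_univ _,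
      mul_pos (Finset.prod_pos fun i _ => ?_) (hQ _)⟩
  · split_ifs
    exacts [ha i, hd i]
  · by_cases hi : a i = 0
    · simpa [hi] using had i hi
    · simpa [hi] using lt_of_le_of_ne (ha i) (Ne.symm hi)

/-- A P-matrix does not reverse the sign of any nonzero vector. -/
theorem PMatrix.eq_zero_of_mul_mulVec_nonpos {n : ℕ} {Q : Matrix (Fin n) (Fin n) ℝ}
    (hQ : PMatrix Q) {x : Fin n → ℝ} (hx : ∀ i, x i * Q.mulVec x i ≤ 0) : x = 0 := by
  by_contra hne
  have hpos := hQ.det_diagonal_mul_add_diagonal_pos (a := fun i => x i ^ 2)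
    (d := fun i => if x i = 0 then 1 else -(x i * Q.mulVec x i)) (fun i => sq_nonneg _)
    (fun i => by split_ifs <;> linarith [hx i])
    (fun i hi => by simp [pow_eq_zero_iff two_ne_zero |>.mp hi])
  refine hpos.ne' (Matrix.exists_mulVec_eq_zero_iff.mp ⟨x, hne, ?_⟩)
  funext i
  rw [Matrix.add_mulVec, ← Matrix.mulVec_mulVec]
  by_cases hi : x i = 0
  · simp [Matrix.mulVec_diagonal, hi, -Matrix.mulVec_mulVec]
  · simp only [Pi.add_apply, Matrix.mulVec_diagonal, hi, if_false, Pi.zero_apply]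
    ring

theorem norm_sub_sq_sum {n : ℕ} (x y : EuclideanSpace ℝ (Fin n ⊕ Fin n)) :
    ‖x - y‖ ^ 2 = ∑ i, ((x (Sum.inl i) - y (Sum.inl i)) ^ 2 +
      (x (Sum.inr i) - y (Sum.inr i)) ^ 2) := by
  rw [EuclideanSpace.real_norm_sq_eq, Fintype.sum_sum_type, Finset.sum_add_distrib]
  rfl

theorem mul_eq_zero_of_mem_C2set {n : ℕ} {w : EuclideanSpace ℝ (Fin n ⊕ Fin n)}
    (hw : w ∈ C2set n) (i : Fin n) : w (Sum.inl i) * w (Sum.inr i) = 0 :=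
  (Finset.sum_eq_zero_iff_of_nonneg fun j _ => mul_nonneg (hw.1 j) (hw.2.1 j)).mp hw.2.2 i
    (Finset.mem_univ i)

/-- Projections onto `C2set` are optimal in each pair of complementary coordinates. -/
theorem sq_add_sq_le_of_mem_projSet_C2set {n : ℕ} {w w' : EuclideanSpace ℝ (Fin n ⊕ Fin n)}
    (h : w' ∈ projSet (C2set n) w) (i : Fin n) {p q : ℝ} (hp : 0 ≤ p) (hq : 0 ≤ q)
    (hpq : p * q = 0) :
    (w' (Sum.inl i) - w (Sum.inl i)) ^ 2 + (w' (Sum.inr i) - w (Sum.inr i)) ^ 2 ≤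
      (p - w (Sum.inl i)) ^ 2 + (q - w (Sum.inr i)) ^ 2 := by
  obtain ⟨hmem, hmin⟩ := h
  let z : EuclideanSpace ℝ (Fin n ⊕ Fin n) := WithLp.toLp 2
    (Sum.elim (Function.update (fun j => w' (Sum.inl j)) i p)
      (Function.update (fun j => w' (Sum.inr j)) i q))
  have hzl : ∀ j, z (Sum.inl j) = if j = i then p else w' (Sum.inl j) := fun j => by
    simp [z, Function.update_apply]
  have hzr : ∀ j, z (Sum.inr j) = if j = i then q else w' (Sum.inr j) := fun j => by
    simp [z, Function.update_apply]
  have hz : z ∈ C2set n := by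
    refine ⟨fun j => ?_, fun j => ?_, Finset.sum_eq_zero fun j _ => ?_⟩
    · rw [hzl]; split_ifs; exacts [hp, hmem.1 j]
    · rw [hzr]; split_ifs; exacts [hq, hmem.2.1 j]
    · rw [hzl, hzr]; split_ifs; exacts [hpq, mul_eq_zero_of_mem_C2set hmem j]
  have hle := pow_le_pow_left₀ (norm_nonneg _) (hmin z hz) 2
  rw [norm_sub_sq_sum, norm_sub_sq_sum, ← Finset.add_sum_erase _ _ (Finset.mem_univ i),
    ← Finset.add_sum_erase (a := i) _ _ (Finset.mem_univ i)] at hle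
  have hrest : ∑ j ∈ Finset.univ.erase i, ((z (Sum.inl j) - w (Sum.inl j)) ^ 2 +
      (z (Sum.inr j) - w (Sum.inr j)) ^ 2) = ∑ j ∈ Finset.univ.erase i,
      ((w' (Sum.inl j) - w (Sum.inl j)) ^ 2 + (w' (Sum.inr j) - w (Sum.inr j)) ^ 2) :=
    Finset.sum_congr rfl fun j hj => by
      rw [hzl, hzr, if_neg (Finset.ne_of_mem_erase hj), if_neg (Finset.ne_of_mem_erase hj)]
  rw [hrest, hzl i, hzr i, if_pos rfl, if_pos rfl] at hle
  linarith

theorem mul_nonneg_of_forall_sq_sub_le {a b u : ℝ} (hu : 0 ≤ u)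
    (h : ∀ p q : ℝ, 0 ≤ p → 0 ≤ q → p * q = 0 →
      (u - a) ^ 2 + (0 - b) ^ 2 ≤ (p - a) ^ 2 + (q - b) ^ 2) : 0 ≤ (a - u) * b := by
  rcases le_total 0 a with ha | ha
  · have hua : a - u = 0 := by nlinarith [h a 0 ha le_rfl (mul_zero _), sq_nonneg (a - u)]
    simp [hua]
  · have hu0 : u = 0 := by nlinarith [h 0 0 le_rfl le_rfl (mul_zero _)]
    subst hu0
    have hb : b ≤ 0 := by
      by_contra! hb
      nlinarith [h 0 b le_rfl hb.le (zero_mul _)]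
    nlinarith

/-- The residual of a projection onto `C2set` has complementary coordinates of the same sign. -/
theorem mul_nonneg_of_mem_projSet_C2set {n : ℕ} {w w' : EuclideanSpace ℝ (Fin n ⊕ Fin n)}
    (h : w' ∈ projSet (C2set n) w) (i : Fin n) :
    0 ≤ (w (Sum.inl i) - w' (Sum.inl i)) * (w (Sum.inr i) - w' (Sum.inr i)) := by
  have hopt : ∀ p q : ℝ, 0 ≤ p → 0 ≤ q → p * q = 0 → _ := fun p q hp hq hpq =>
    sq_add_sq_le_of_mem_projSet_C2set h i hp hq hpq
  rcases mul_eq_zero.mp (mul_eq_zero_of_mem_C2set h.1 i) with h0 | h0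
  · rw [h0] at hopt ⊢
    rw [sub_zero, mul_comm]
    refine mul_nonneg_of_forall_sq_sub_le (h.1.2.1 i) fun p q hp hq hpq => ?_
    linarith [hopt q p hq hp (by rw [mul_comm, hpq])]
  · rw [h0] at hopt ⊢
    rw [sub_zero]
    exact mul_nonneg_of_forall_sq_sub_le (h.1.1 i) hopt

/-- The residual of a projection onto `C1set` is orthogonal to the kernel of `Tmap`. -/
theorem inner_eq_zero_of_mem_projSet_C1set {m n : ℕ} {A B : Matrix (Fin m) (Fin n) ℝ}
    {c : Fin m → ℝ} {w w' : EuclideanSpace ℝ (Fin n ⊕ Fin n)}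
    (h : w ∈ projSet (C1set A B c) w') {k : EuclideanSpace ℝ (Fin n ⊕ Fin n)}
    (hk : Tmap A B k = 0) : inner ℝ (w - w') k = 0 := by
  have hmem : ∀ t : ℝ, w + t • k ∈ C1set A B c := fun t => by
    have hT : Tmap A B (w + t • k) = Tmap A B w + t • Tmap A B k := by
      simp only [Tmap, smul_add, ← Matrix.mulVec_smul]
      rw [add_add_add_comm, ← Matrix.mulVec_add, ← Matrix.mulVec_add]
      rfl
    change Tmap A B _ = _
    rw [hT, hk, smul_zero, add_zero]
    exact h.1
  have hquad : ∀ t : ℝ, 0 ≤ ‖k‖ ^ 2 * (t * t) + (2 * inner ℝ (w - w') k) * t + 0 := fun t => by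
    have hle := pow_le_pow_left₀ (norm_nonneg _) (h.2 _ (hmem t)) 2
    rw [add_sub_right_comm, norm_add_sq_real, inner_smul_right, norm_smul, mul_pow,
      Real.norm_eq_abs, sq_abs] at hle
    linarith
  have hdisc := discrim_le_zero hquad
  rw [discrim] at hdisc
  nlinarith [sq_nonneg (inner ℝ (w - w') k)]

/-- A residual of a projection onto `C1set` has the form `(-Q y, y)`. -/
theorem residual_eq_neg_mulVec {n : ℕ} {A B : Matrix (Fin n) (Fin n) ℝ} (hAB : IsUnit (A - B))
    {c : Fin n → ℝ} {w w' : EuclideanSpace ℝ (Fin n ⊕ Fin n)}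
    (h : w ∈ projSet (C1set A B c) w') (i : Fin n) :
    w (Sum.inl i) - w' (Sum.inl i) =
      -((A.transpose + B.transpose) * (A.transpose - B.transpose)⁻¹).mulVec
        (fun j => w (Sum.inr j) - w' (Sum.inr j)) i := by
  set G := (A - B)⁻¹ * (A + B) with hG
  have hQ : (A.transpose + B.transpose) * (A.transpose - B.transpose)⁻¹ = G.transpose := by
    rw [hG, Matrix.transpose_mul, Matrix.transpose_nonsing_inv, Matrix.transpose_add,
      Matrix.transpose_sub]
  have hdet := (Matrix.isUnit_iff_isUnit_det _).mp hAB
  let k : EuclideanSpace ℝ (Fin n ⊕ Fin n) :=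
    WithLp.toLp 2 (Sum.elim (Pi.single i 1) (G.mulVec (Pi.single i 1)))
  have hk : Tmap A B k = 0 := by
    change (A + B).mulVec (Pi.single i 1) + (-A + B).mulVec (G.mulVec (Pi.single i 1)) = 0
    rw [show -A + B = -(A - B) by abel, Matrix.neg_mulVec, Matrix.mulVec_mulVec, hG,
      Matrix.mul_nonsing_inv_cancel_left _ _ hdet, add_neg_cancel]
  have hinner := inner_eq_zero_of_mem_projSet_C1set h hk
  rw [PiLp.inner_apply, Fintype.sum_sum_type] at hinner
  simp only [PiLp.sub_apply, Matrix.mulVec_single, MulOpposite.op_one, one_smul, Sum.elim_inl,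
    Pi.single_apply, RCLike.inner_apply, Real.ringHom_apply, ite_mul, one_mul, zero_mul,
    Finset.sum_ite_eq', Finset.mem_univ, ↓reduceIte, Sum.elim_inr, Matrix.col_apply, k] at hinner
  rw [hQ, Matrix.mulVec, dotProduct]
  simp only [Matrix.transpose_apply]
  linarith

theorem fixed_points_characterization_Pmatrix {n : ℕ}
    (A B : Matrix (Fin n) (Fin n) ℝ) (hAB : IsUnit (A - B))
    (hQnd : PMatrix ((A.transpose + B.transpose) * (A.transpose - B.transpose)⁻¹)) :
    ∀ c : Fin n → ℝ, FixSet A B c = C1set A B c ∩ C2set n := by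
  intro c
  ext w
  constructor
  · rintro ⟨w', hw', hw⟩
    have hres := residual_eq_neg_mulVec hAB hw
    have hr := hQnd.eq_zero_of_mul_mulVec_nonpos
      (x := fun j => w (Sum.inr j) - w' (Sum.inr j)) fun i => by
        have hi := mul_nonneg_of_mem_projSet_C2set hw' i
        rw [hres i] at hi
        linarith
    have hww' : w = w' := by
      ext (i | i)
      · have hi := hres i
        rw [hr, Matrix.mulVec_zero, Pi.zero_apply, neg_zero] at hi
        exact sub_eq_zero.mp hi
      · exact sub_eq_zero.mp (congrFun hr i)
    exact ⟨hw.1, hww' ▸ hw'.1⟩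
  · rintro ⟨h1, h2⟩
    exact ⟨w, ⟨h2, fun t _ => by simp⟩, h1, fun t _ => by simp⟩
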